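/- Let f : ℝ → ℝ be represented by a ReLU DNN with k ≥ 1 hidden layers of widths w₁,…,w_k. Then f is a continuous piecewise linear function with at most 2^{k−1}·(w₁+1)·w₂·⋯·w_k pieces. -/

import Mathlib

open scoped BigOperators

noncomputable section

/-- Coordinatewise ReLU activation. -/
def reluVec {n : ℕ} (x : Fin n → ℝ) : Fin n → ℝ := fun i => max (x i) 0

/-- `T` is an affine transformation. -/
def IsAffineT {n m : ℕ} (T : (Fin n → ℝ) → (Fin m → ℝ)) : Prop :=
  ∃ (A : Matrix (Fin m) (Fin n) ℝ) (b : Fin m → ℝ), ∀ x, T x = A.mulVec x + b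

/-- `T` is a linear transformation. -/
def IsLinearT {n m : ℕ} (T : (Fin n → ℝ) → (Fin m → ℝ)) : Prop :=
  ∃ A : Matrix (Fin m) (Fin n) ℝ, ∀ x, T x = A.mulVec x

/-- `RepresentsWith ws f` : the function `f : ℝ^n → ℝ^m` is computed by a ReLU DNN whose
hidden layers have widths given by the list `ws` (so the DNN has `ws.length` hidden layers,
depth `ws.length + 1` and size `ws.sum`). -/
def RepresentsWithAux : List ℕ → (n m : ℕ) → ((Fin n → ℝ) → (Fin m → ℝ)) → Prop
  | [], _, _, f => IsLinearT f
  | w :: ws, n, m, f =>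
      ∃ (T : (Fin n → ℝ) → (Fin w → ℝ)) (g : (Fin w → ℝ) → (Fin m → ℝ)),
        IsAffineT T ∧ RepresentsWithAux ws w m g ∧ ∀ x, f x = g (reluVec (T x))

/-- See `RepresentsWithAux`. -/
def RepresentsWith (ws : List ℕ) {n m : ℕ} (f : (Fin n → ℝ) → (Fin m → ℝ)) : Prop :=
  RepresentsWithAux ws n m f

/-- Representability for real-valued functions on `ℝ^n`. -/
def RepresentsR (ws : List ℕ) {n : ℕ} (f : (Fin n → ℝ) → ℝ) : Prop :=
  RepresentsWith ws (fun x => fun _ : Fin 1 => f x)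

/-- Representability for `ℝ → ℝ` functions. -/
def Represents1D (ws : List ℕ) (f : ℝ → ℝ) : Prop :=
  RepresentsWith ws (fun x : Fin 1 → ℝ => fun _ : Fin 1 => f (x 0))

/-- `f` agrees with an affine function on the set `S`. -/
def AffineOnSet {n : ℕ} (f : (Fin n → ℝ) → ℝ) (S : Set (Fin n → ℝ)) : Prop :=
  ∃ (c : Fin n → ℝ) (d : ℝ), ∀ x ∈ S, f x = (∑ j, c j * x j) + d

/-- A polyhedron: the intersection of finitely many halfspaces. -/
def IsPolyhedron {n : ℕ} (P : Set (Fin n → ℝ)) : Prop :=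
  ∃ (m : ℕ) (A : Fin m → Fin n → ℝ) (b : Fin m → ℝ),
    P = {x | ∀ i, (∑ j, A i j * x j) ≤ b i}

/-- Continuous piecewise linear function on `ℝ^n`: finitely many polyhedra covering `ℝ^n`,
with `f` affine on each. -/
def IsPWL {n : ℕ} (f : (Fin n → ℝ) → ℝ) : Prop :=
  ∃ (N : ℕ) (P : Fin N → Set (Fin n → ℝ)),
    (∀ i, IsPolyhedron (P i)) ∧ (⋃ i, P i) = Set.univ ∧ ∀ i, AffineOnSet f (P i)

/-- `f : ℝ → ℝ` is piecewise linear with breakpoints `b 0 < b 1 < ⋯ < b (q-1)`, being affine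
with slope `sl i` and intercept `ic i` on the `i`-th of the `q+1` closed pieces into which the
breakpoints partition `ℝ`. -/
def RealizesPieces (q : ℕ) (b : Fin q → ℝ) (sl ic : Fin (q+1) → ℝ) (f : ℝ → ℝ) : Prop :=
  StrictMono b ∧
  ∀ (i : Fin (q+1)) (x : ℝ),
    (∀ j : Fin q, (j : ℕ) < (i : ℕ) → b j ≤ x) →
    (∀ j : Fin q, (i : ℕ) ≤ (j : ℕ) → x ≤ b j) →
    f x = sl i * x + ic i

/-- `f : ℝ → ℝ` is continuous piecewise linear with exactly `p` pieces: `ℝ` is partitioned into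
`p` intervals on each of which `f` is affine, and consecutive pieces have different slopes. -/
def PWLPiecesExact (p : ℕ) (f : ℝ → ℝ) : Prop :=
  ∃ q : ℕ, p = q + 1 ∧ ∃ (b : Fin q → ℝ) (sl ic : Fin (q+1) → ℝ),
    RealizesPieces q b sl ic f ∧ ∀ i : Fin q, sl i.castSucc ≠ sl i.succ

/-- `f : ℝ → ℝ` is continuous piecewise linear with at most `p` pieces. -/
def PWLPiecesAtMost (p : ℕ) (f : ℝ → ℝ) : Prop :=
  ∃ q : ℕ, q + 1 ≤ p ∧ ∃ (b : Fin q → ℝ) (sl ic : Fin (q+1) → ℝ),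
    RealizesPieces q b sl ic f

/-- Membership in the simplex `Δ^p_M = {x : 0 < x 0 < x 1 < ⋯ < x (p-1) < M}`. -/
def InSimplex (M : ℝ) {p : ℕ} (a : Fin p → ℝ) : Prop :=
  StrictMono a ∧ (∀ i, 0 < a i) ∧ ∀ i, a i < M

/-- The knots `0, a 0, a 1, …, a (p-1), M` of the function `h_a`. -/
def knot (M : ℝ) {p : ℕ} (a : Fin p → ℝ) (i : Fin (p+2)) : ℝ :=
  if _h0 : (i : ℕ) = 0 then 0
  else if _h1 : (i : ℕ) = p + 1 then M
  else a ⟨(i : ℕ) - 1, by have := i.isLt; omega⟩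

/-- The prescribed value of `h_a` at the `i`-th knot: it alternates `0, M, 0, M, …`. -/
def knotVal (M : ℝ) (p : ℕ) (i : Fin (p+2)) : ℝ :=
  if (i : ℕ) % 2 = 1 then M else 0

/-- `h` is the function `h_a` associated with `a ∈ Δ^p_M`: it vanishes on `(-∞,0]`, is affine on
each interval between consecutive knots with the prescribed alternating values `0,M,0,M,…` at
the knots, and for `x ≥ M` it linearly continues the piece on `[a (p-1), M]`. -/
def IsHa (M : ℝ) {p : ℕ} (a : Fin p → ℝ) (h : ℝ → ℝ) : Prop :=
  (∀ x : ℝ, x ≤ 0 → h x = 0) ∧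
  (∀ i : Fin (p+1), ∀ t ∈ Set.Icc (0:ℝ) 1,
      h ((1 - t) * knot M a i.castSucc + t * knot M a i.succ)
        = (1 - t) * knotVal M p i.castSucc + t * knotVal M p i.succ) ∧
  (∀ x : ℝ, M ≤ x →
      h x = knotVal M p (Fin.last (p+1))
        + (x - M) * ((knotVal M p (Fin.last (p+1)) - knotVal M p ⟨p, by omega⟩)
            / (M - knot M a ⟨p, by omega⟩)))

/-- The composition `h (k-1) ∘ ⋯ ∘ h 1 ∘ h 0` of a finite family of `ℝ → ℝ` functions. -/
def compFold {k : ℕ} (h : Fin k → ℝ → ℝ) : ℝ → ℝ :=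
  fun x => (List.ofFn h).foldl (fun y g => g y) x

/-- `[0,M]` is partitioned into exactly `N` subintervals, on each of which `f` is affine
with minimum value `0` and maximum value `M`. -/
def PartitionAffineMinMax (f : ℝ → ℝ) (M : ℝ) (N : ℕ) : Prop :=
  ∃ c : Fin (N+1) → ℝ, StrictMono c ∧ c 0 = 0 ∧ c (Fin.last N) = M ∧
    ∀ i : Fin N,
      (∃ s d : ℝ, ∀ x ∈ Set.Icc (c i.castSucc) (c i.succ), f x = s * x + d) ∧
      (∀ x ∈ Set.Icc (c i.castSucc) (c i.succ), 0 ≤ f x ∧ f x ≤ M) ∧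
      (∃ x ∈ Set.Icc (c i.castSucc) (c i.succ), f x = 0) ∧
      (∃ x ∈ Set.Icc (c i.castSucc) (c i.succ), f x = M)

/-- `[0,M]` is partitioned into exactly `N` maximal subintervals of affinity of `f`:
`f` is affine on each subinterval and consecutive subintervals carry different slopes. -/
def PartitionAffineExact (f : ℝ → ℝ) (M : ℝ) (N : ℕ) : Prop :=
  ∃ (c : Fin (N+1) → ℝ) (s d : Fin N → ℝ), StrictMono c ∧ c 0 = 0 ∧ c (Fin.last N) = M ∧
    (∀ i : Fin N, ∀ x ∈ Set.Icc (c i.castSucc) (c i.succ), f x = s i * x + d i) ∧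
    ∀ i j : Fin N, (j : ℕ) = (i : ℕ) + 1 → s i ≠ s j

/-- The zonotope `Z(b 0, …, b (m-1)) = {λ₀ b⁰ + ⋯ + λ_{m-1} b^{m-1} : |λᵢ| ≤ 1}`. -/
def Zono {n m : ℕ} (b : Fin m → Fin n → ℝ) : Set (Fin n → ℝ) :=
  {x | ∃ lam : Fin m → ℝ, (∀ i, |lam i| ≤ 1) ∧ x = ∑ i, lam i • b i}

/-- The set of maximal connected subsets of `ℝ^n` on which `f` is affine (the "pieces"). -/
def MaxAffinePieces {n : ℕ} (f : (Fin n → ℝ) → ℝ) : Set (Set (Fin n → ℝ)) :=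
  {S | IsConnected S ∧ AffineOnSet f S ∧
    ∀ S', IsConnected S' → AffineOnSet f S' → S ⊆ S' → S' = S}

end

/-- `f` is affine on every set that lies on one side of each point of `B`. -/
def AffineBetween (B : Finset ℝ) (f : ℝ → ℝ) : Prop :=
  ∀ I : Set ℝ, (∀ b ∈ B, (∀ x ∈ I, x ≤ b) ∨ (∀ x ∈ I, b ≤ x)) →
    ∃ s c : ℝ, ∀ x ∈ I, f x = s * x + c

theorem AffineBetween.mulVec {B : Finset ℝ} {n m : ℕ} {F : ℝ → Fin n → ℝ}
    (hF : ∀ i, AffineBetween B (fun x => F x i)) (A : Matrix (Fin m) (Fin n) ℝ)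
    (d : Fin m → ℝ) (i : Fin m) :
    AffineBetween B (fun x => (A.mulVec (F x) + d) i) := by
  intro I hI
  choose s c h using fun j => hF j I hI
  refine ⟨∑ j, A i j * s j, ∑ j, A i j * c j + d i, fun x hx => ?_⟩
  have hA : A.mulVec (F x) i = ∑ j, (A i j * s j * x + A i j * c j) := by
    rw [Matrix.mulVec, dotProduct]
    refine Finset.sum_congr rfl fun j _ => ?_
    rw [show F x j = s j * x + c j from h j x hx]
    ring
  change A.mulVec (F x) i + d i = _
  rw [hA, Finset.sum_add_distrib, Finset.sum_mul]
  ring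

/-- The closed piece of `ℝ` cut out by `B` that starts at the given point of `B`
(at `-∞` for `none`). -/
def pieceFrom (B : Finset ℝ) : Option B → Set ℝ
  | none => {x | ∀ b ∈ B, x ≤ b}
  | some a => {x | (a : ℝ) ≤ x ∧ ∀ b ∈ B, (a : ℝ) < b → x ≤ b}

theorem pieceFrom_one_side (B : Finset ℝ) (o : Option B) :
    ∀ b ∈ B, (∀ x ∈ pieceFrom B o, x ≤ b) ∨ (∀ x ∈ pieceFrom B o, b ≤ x) := by
  intro b hb
  cases o with
  | none => exact Or.inl fun x hx => hx b hb
  | some a =>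
    rcases le_or_gt b a with hab | hab
    · exact Or.inr fun x hx => hab.trans hx.1
    · exact Or.inl fun x hx => hx.2 b hb hab

theorem exists_subset_pieceFrom {B : Finset ℝ} {I : Set ℝ}
    (hI : ∀ b ∈ B, (∀ x ∈ I, x ≤ b) ∨ (∀ x ∈ I, b ≤ x)) : ∃ o, I ⊆ pieceFrom B o := by
  classical
  by_cases hL : (B.filter fun b => ∀ x ∈ I, b ≤ x).Nonempty
  · obtain ⟨a, ha, hmax⟩ := Finset.exists_max_image _ id hL
    rw [Finset.mem_filter] at ha
    refine ⟨some ⟨a, ha.1⟩, fun x hx => ⟨ha.2 x hx, fun b hb hab => ?_⟩⟩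
    rcases hI b hb with h | h
    · exact h x hx
    · exact absurd (hmax b (Finset.mem_filter.2 ⟨hb, h⟩)) (not_le.2 hab)
  · refine ⟨none, fun x hx b hb => ?_⟩
    rcases hI b hb with h | h
    · exact h x hx
    · exact absurd ⟨b, Finset.mem_filter.2 ⟨hb, h⟩⟩ hL

theorem exists_affine_max_zero {I : Set ℝ} {s c : ℝ}
    (hI : (∀ x ∈ I, x ≤ -c / s) ∨ (∀ x ∈ I, -c / s ≤ x)) :
    ∃ s' c' : ℝ, ∀ x ∈ I, max (s * x + c) 0 = s' * x + c' := by
  rcases lt_trichotomy s 0 with hs | rfl | hs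
  · rcases hI with h | h
    · refine ⟨s, c, fun x hx => max_eq_left ?_⟩
      have := (le_div_iff_of_neg hs).1 (h x hx)
      linarith
    · refine ⟨0, 0, fun x hx => ?_⟩
      have := (div_le_iff_of_neg hs).1 (h x hx)
      rw [max_eq_right (by linarith)]
      ring
  · exact ⟨0, max c 0, fun x _ => by simp⟩
  · rcases hI with h | h
    · refine ⟨0, 0, fun x hx => ?_⟩
      have := (le_div_iff₀ hs).1 (h x hx)
      rw [max_eq_right (by linarith)]
      ring
    · refine ⟨s, c, fun x hx => max_eq_left ?_⟩
      have := (div_le_iff₀ hs).1 (h x hx)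
      linarith

theorem AffineBetween.reluVec {B : Finset ℝ} {w : ℕ} {F : ℝ → Fin w → ℝ}
    (hF : ∀ i, AffineBetween B (fun x => F x i)) :
    ∃ B' : Finset ℝ, B'.card + 1 ≤ (B.card + 1) * (w + 1) ∧
      ∀ i, AffineBetween B' (fun x => _root_.reluVec (F x) i) := by
  classical
  choose s c h using fun (p : Option B × Fin w) =>
    hF p.2 (pieceFrom B p.1) (pieceFrom_one_side B p.1)
  refine ⟨B ∪ Finset.univ.image fun p => -c p / s p, ?_, fun i I hI => ?_⟩
  · have h₁ := Finset.card_union_le B (Finset.univ.image fun p => -c p / s p)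
    have h₂ : (Finset.univ.image fun p => -c p / s p).card ≤ (B.card + 1) * w := by
      refine Finset.card_image_le.trans ?_
      simp
    rw [mul_add]
    omega
  · obtain ⟨o, ho⟩ := exists_subset_pieceFrom fun b hb => hI b (Finset.mem_union_left _ hb)
    obtain ⟨s', c', h'⟩ := exists_affine_max_zero (hI (-c (o, i) / s (o, i))
      (Finset.mem_union_right _ (Finset.mem_image_of_mem _ (Finset.mem_univ _))))
    refine ⟨s', c', fun x hx => ?_⟩
    rw [← h' x hx, ← h (o, i) x (ho hx)]
    rfl

theorem RepresentsWithAux.exists_affineBetween (ws : List ℕ) :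
    ∀ {n m : ℕ} {g : (Fin n → ℝ) → (Fin m → ℝ)}, RepresentsWithAux ws n m g →
      ∀ {B : Finset ℝ} {F : ℝ → Fin n → ℝ}, (∀ i, AffineBetween B (fun x => F x i)) →
        ∃ B' : Finset ℝ, B'.card + 1 ≤ (B.card + 1) * (ws.map (· + 1)).prod ∧
          ∀ i, AffineBetween B' (fun x => g (F x) i) := by
  induction ws with
  | nil =>
    rintro n m g ⟨A, hA⟩ B F hF
    refine ⟨B, by simp, fun i => ?_⟩
    simpa [hA] using AffineBetween.mulVec hF A 0 i
  | cons w ws ih =>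
    rintro n m g ⟨T, g', ⟨A, d, hT⟩, hg', hg⟩ B F hF
    obtain ⟨B₁, hB₁, hF₁⟩ := AffineBetween.reluVec (AffineBetween.mulVec hF A d)
    obtain ⟨B₂, hB₂, hF₂⟩ := ih hg' hF₁
    refine ⟨B₂, ?_, fun i => ?_⟩
    · rw [List.map_cons, List.prod_cons, ← mul_assoc]
      exact hB₂.trans (Nat.mul_le_mul_right _ hB₁)
    · simpa only [hg, hT] using hF₂ i

theorem AffineBetween.pwlPiecesAtMost {B : Finset ℝ} {f : ℝ → ℝ} (hf : AffineBetween B f)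
    {p : ℕ} (hp : B.card + 1 ≤ p) : PWLPiecesAtMost p f := by
  let b := B.orderEmbOfFin rfl
  have key : ∀ i : Fin (B.card + 1), ∃ s c : ℝ,
      ∀ x ∈ {x : ℝ | (∀ j : Fin B.card, (j : ℕ) < (i : ℕ) → b j ≤ x) ∧
        ∀ j : Fin B.card, (i : ℕ) ≤ (j : ℕ) → x ≤ b j}, f x = s * x + c := by
    refine fun i => hf _ fun y hy => ?_
    obtain ⟨j, rfl⟩ : y ∈ Set.range b := by
      rw [Finset.range_orderEmbOfFin]
      exact hy
    rcases lt_or_ge (j : ℕ) (i : ℕ) with hji | hji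
    · exact Or.inr fun x hx => hx.1 j hji
    · exact Or.inl fun x hx => hx.2 j hji
  choose s c h using key
  exact ⟨B.card, hp, b, s, c, b.strictMono, fun i x h₁ h₂ => h i x ⟨h₁, h₂⟩⟩

theorem List.prod_map_succ_le_two_pow_mul_prod {l : List ℕ} (hl : ∀ u ∈ l, 0 < u) :
    (l.map (· + 1)).prod ≤ 2 ^ l.length * l.prod := by
  induction l with
  | nil => simp
  | cons u l ih =>
    rw [List.forall_mem_cons] at hl
    have hu : u + 1 ≤ 2 * u := by omega
    calc ((u :: l).map (· + 1)).prod = (u + 1) * (l.map (· + 1)).prod := by simp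
      _ ≤ 2 * u * (2 ^ l.length * l.prod) := Nat.mul_le_mul hu (ih hl.2)
      _ = 2 ^ (u :: l).length * (u :: l).prod := by
        rw [List.length_cons, List.prod_cons, pow_succ]
        ring

/-- If `f : ℝ → ℝ` is represented by a ReLU DNN with `k ≥ 1` hidden layers of
(positive) widths `w₁, …, w_k`, then `f` is continuous piecewise linear with at most
`2^{k−1}·(w₁+1)·w₂⋯w_k` pieces. -/
theorem stmt18 (w₁ : ℕ) (rest : List ℕ) (hpos : ∀ u ∈ rest, 0 < u) (f : ℝ → ℝ)
    (h : Represents1D (w₁ :: rest) f) :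
    PWLPiecesAtMost (2 ^ rest.length * (w₁ + 1) * rest.prod) f := by
  have hid : ∀ i : Fin 1, AffineBetween ∅ (fun x => (fun _ : Fin 1 => x) i) :=
    fun _ _ _ => ⟨1, 0, fun x _ => by simp⟩
  obtain ⟨B, hB, hf⟩ := RepresentsWithAux.exists_affineBetween _ h hid
  refine (hf 0).pwlPiecesAtMost (hB.trans ?_)
  have hrest := Nat.mul_le_mul_left (w₁ + 1) (List.prod_map_succ_le_two_pow_mul_prod hpos)
  simp only [Finset.card_empty, zero_add, one_mul, List.map_cons, List.prod_cons]
  exact hrest.trans (by rw [← mul_assoc, mul_comm (w₁ + 1)])
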